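/- For any strictly positive joint distribution p on C × K and any strictly positive conditional distribution q from C to K, the variational estimator satisfies |I_θ(p,q) − I(p)| ≤ max( KL(p ‖ q̃), KL(p_C ⊗ p_K ‖ q̃) ), where p_C ⊗ p_K is the product distribution (c,k) ↦ p_C(c)·p_K(k). -/

import Mathlib

open Finset

/-- Marginal on the first coordinate: `p_C(c) = ∑ₖ p(c,k)`. -/
noncomputable def margC {C K : Type*} [Fintype K] (p : C × K → ℝ) (c : C) : ℝ :=
  ∑ k, p (c, k)

/-- Marginal on the second coordinate: `p_K(k) = ∑_c p(c,k)`. -/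
noncomputable def margK {C K : Type*} [Fintype C] (p : C × K → ℝ) (k : K) : ℝ :=
  ∑ c, p (c, k)

/-- Conditional distribution: `p(k|c) = p(c,k) / p_C(c)`. -/
noncomputable def condK {C K : Type*} [Fintype K] (p : C × K → ℝ) (c : C) (k : K) : ℝ :=
  p (c, k) / margC p c

/-- Mutual information `I(p) = ∑_{(c,k)} p(c,k) log (p(c,k) / (p_C(c) p_K(k)))`. -/
noncomputable def mutInfo {C K : Type*} [Fintype C] [Fintype K] (p : C × K → ℝ) : ℝ :=
  ∑ ck : C × K, p ck * Real.log (p ck / (margC p ck.1 * margK p ck.2))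

/-- The plug-in estimator
`I_est(p) = ∑ p(c,k) log p(k|c) − ∑ p_C(c) p_K(k) log p(k|c)`. -/
noncomputable def Iest {C K : Type*} [Fintype C] [Fintype K] (p : C × K → ℝ) : ℝ :=
  (∑ ck : C × K, p ck * Real.log (condK p ck.1 ck.2)) -
    ∑ ck : C × K, margC p ck.1 * margK p ck.2 * Real.log (condK p ck.1 ck.2)

/-- The variational estimator, for `q (c,k) = q(k|c)` a conditional distribution:
`I_θ(p,q) = ∑ p(c,k) log q(k|c) − ∑ p_C(c) p_K(k) log q(k|c)`. -/
noncomputable def Itheta {C K : Type*} [Fintype C] [Fintype K] (p q : C × K → ℝ) : ℝ :=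
  (∑ ck : C × K, p ck * Real.log (q ck)) -
    ∑ ck : C × K, margC p ck.1 * margK p ck.2 * Real.log (q ck)

/-- Kullback–Leibler divergence of finitely supported positive distributions. -/
noncomputable def KLdiv {A : Type*} [Fintype A] (r s : A → ℝ) : ℝ :=
  ∑ a, r a * Real.log (r a / s a)

theorem sum_margC {C K : Type*} [Fintype C] [Fintype K] (p : C × K → ℝ) :
    ∑ c, margC p c = ∑ ck : C × K, p ck :=
  (Fintype.sum_prod_type p).symm

/-- Gibbs' inequality. -/
theorem KLdiv_nonneg {A : Type*} [Fintype A] {r s : A → ℝ} (hr : ∀ a, 0 < r a)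
    (hs : ∀ a, 0 < s a) (hrs : ∑ a, s a = ∑ a, r a) : 0 ≤ KLdiv r s := by
  have h : ∑ a, (r a - s a) ≤ KLdiv r s := by
    refine Finset.sum_le_sum fun a _ => ?_
    have hlog := Real.log_le_sub_one_of_pos (div_pos (hs a) (hr a))
    rw [← inv_div, Real.log_inv, inv_div] at hlog
    have hmul := mul_le_mul_of_nonneg_left hlog (hr a).le
    have hcancel : r a * (s a / r a - 1) = s a - r a := by
      have := (hr a).ne'
      field_simp
    linarith
  rwa [Finset.sum_sub_distrib, hrs, sub_self] at h

/-- The product of the marginals has the same second marginal as the joint distribution. -/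
theorem sum_margC_mul_margK_mul {C K : Type*} [Fintype C] [Fintype K] {p : C × K → ℝ}
    (hsum : ∑ ck : C × K, p ck = 1) (f : K → ℝ) :
    ∑ ck : C × K, margC p ck.1 * margK p ck.2 * f ck.2 = ∑ ck : C × K, p ck * f ck.2 := by
  simp only [Fintype.sum_prod_type_right, mul_assoc, ← Finset.sum_mul, sum_margC, hsum, one_mul,
    margK]

/-- The error of the variational estimator is a difference of two divergences. -/
theorem Itheta_sub_mutInfo {C K : Type*} [Fintype C] [Fintype K] {p q : C × K → ℝ}
    (hpos : ∀ ck, 0 < p ck) (hsum : ∑ ck : C × K, p ck = 1) (hqpos : ∀ ck, 0 < q ck)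
    (hC : ∀ c, 0 < margC p c) (hK : ∀ k, 0 < margK p k) :
    Itheta p q - mutInfo p =
      KLdiv (fun ck : C × K => margC p ck.1 * margK p ck.2)
          (fun ck : C × K => margC p ck.1 * q ck) -
        KLdiv p (fun ck : C × K => margC p ck.1 * q ck) := by
  have hmarg := sum_margC_mul_margK_mul hsum fun k => Real.log (margK p k)
  have hI : mutInfo p = ∑ ck : C × K, p ck * Real.log (p ck) -
      ∑ ck : C × K, p ck * Real.log (margC p ck.1) -
        ∑ ck : C × K, p ck * Real.log (margK p ck.2) := by
    simp only [mutInfo, ← Finset.sum_sub_distrib]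
    refine Finset.sum_congr rfl fun ck _ => ?_
    rw [Real.log_div (hpos ck).ne' (mul_pos (hC _) (hK _)).ne',
      Real.log_mul (hC _).ne' (hK _).ne']
    ring
  have hjoint : KLdiv p (fun ck : C × K => margC p ck.1 * q ck) =
      ∑ ck : C × K, p ck * Real.log (p ck) -
        ∑ ck : C × K, p ck * Real.log (margC p ck.1) - ∑ ck : C × K, p ck * Real.log (q ck) := by
    simp only [KLdiv, ← Finset.sum_sub_distrib]
    refine Finset.sum_congr rfl fun ck _ => ?_
    rw [Real.log_div (hpos ck).ne' (mul_pos (hC _) (hqpos ck)).ne',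
      Real.log_mul (hC _).ne' (hqpos ck).ne']
    ring
  have hprod : KLdiv (fun ck : C × K => margC p ck.1 * margK p ck.2)
        (fun ck : C × K => margC p ck.1 * q ck) =
      ∑ ck : C × K, margC p ck.1 * margK p ck.2 * Real.log (margK p ck.2) -
        ∑ ck : C × K, margC p ck.1 * margK p ck.2 * Real.log (q ck) := by
    simp only [KLdiv, ← Finset.sum_sub_distrib]
    refine Finset.sum_congr rfl fun ck _ => ?_
    rw [mul_div_mul_left _ _ (hC _).ne', Real.log_div (hK _).ne' (hqpos ck).ne']
    ring
  rw [hI, hjoint, hprod, Itheta]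
  linarith

/-- **Final bound in the proof of Proposition 1.4 (discrete form).**
`|I_θ(p,q) − I(p)| ≤ max (KL(p ‖ q̃)) (KL(p_C ⊗ p_K ‖ q̃))` with `q̃(c,k) = p_C(c) q(k|c)`. -/
theorem abs_Itheta_sub_mutInfo_le {C K : Type*} [Fintype C] [Fintype K] [Nonempty C] [Nonempty K]
    (p q : C × K → ℝ) (hpos : ∀ ck, 0 < p ck) (hsum : ∑ ck : C × K, p ck = 1)
    (hqpos : ∀ ck, 0 < q ck) (hqsum : ∀ c, ∑ k, q (c, k) = 1) :
    |Itheta p q - mutInfo p| ≤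
      max (KLdiv p (fun ck : C × K => margC p ck.1 * q ck))
        (KLdiv (fun ck : C × K => margC p ck.1 * margK p ck.2)
          (fun ck : C × K => margC p ck.1 * q ck)) := by
  have hC : ∀ c, 0 < margC p c := fun c =>
    Finset.sum_pos (fun k _ => hpos (c, k)) Finset.univ_nonempty
  have hK : ∀ k, 0 < margK p k := fun k =>
    Finset.sum_pos (fun c _ => hpos (c, k)) Finset.univ_nonempty
  have hq : ∑ ck : C × K, margC p ck.1 * q ck = 1 := by
    simp only [Fintype.sum_prod_type, ← Finset.mul_sum, hqsum, mul_one, sum_margC]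
    exact (Fintype.sum_prod_type p).symm.trans hsum
  have hprod : ∑ ck : C × K, margC p ck.1 * margK p ck.2 = 1 := by
    simpa [hsum] using sum_margC_mul_margK_mul hsum fun _ => 1
  have hqpos' : ∀ ck : C × K, 0 < margC p ck.1 * q ck := fun ck => mul_pos (hC _) (hqpos ck)
  have hKLprod := KLdiv_nonneg (fun ck : C × K => mul_pos (hC ck.1) (hK ck.2)) hqpos'
    (hq.trans hprod.symm)
  have hKLjoint := KLdiv_nonneg hpos hqpos' (hq.trans hsum.symm)
  rw [Itheta_sub_mutInfo hpos hsum hqpos hC hK, abs_sub_le_iff]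
  exact ⟨(sub_le_self _ hKLjoint).trans (le_max_right _ _),
    (sub_le_self _ hKLprod).trans (le_max_left _ _)⟩
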